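/- Let M : ℝ^d × (0,∞) → ℝ^d and suppose x : (0,∞) → ℝ^d is differentiable with x'(u) = (x(u) − M(x(u), u))/u for all u > 0 (a solution of the probability flow ODE with posterior-mean field M). Fix 0 < s ≤ t and set s' = s/(1+s), t' = t/(1+t). Define y(u') = (1−u') • x(u'/(1−u')) for u' ∈ (0,1). Then: (a) y is differentiable on (0,1) with y'(u') = (y(u') − M(y(u')/(1−u'), u'/(1−u')))/u' (i.e., y solves the corresponding Flow Matching ODE); (b) y(t') = x(t)/(1+t); and (c) x(s) = (1+s) • y(s'). Hence the CTM solution map satisfies G_CTM(x_t, t, s) = G_GCTM(x̄_{t'}, t', s') · (1+s) with x̄_{t'} = x_t/(1+t). -/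

import Mathlib

/-- **CTM / GCTM solution-map correspondence (Theorem 2(ii)).**
Let `x` solve the probability flow ODE `x'(u) = (x(u) − M(x(u), u))/u` on `(0,∞)` with
posterior-mean field `M`. Fix `0 < s ≤ t`, `s' = s/(1+s)`, `t' = t/(1+t)`, and define
`y(u') = (1−u') • x(u'/(1−u'))` on `(0,1)`. Then (a) `y` solves the Flow Matching ODE
`y'(u') = (y(u') − M(y(u')/(1−u'), u'/(1−u')))/u'`; (b) `y(t') = x(t)/(1+t)`; and
(c) `x(s) = (1+s) • y(s')`, i.e. `G_CTM(x_t,t,s) = G_GCTM(x̄_{t'},t',s')·(1+s)`. -/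
theorem ctm_gctm_correspondence
    {d : ℕ}
    (M : EuclideanSpace ℝ (Fin d) → ℝ → EuclideanSpace ℝ (Fin d))
    (x : ℝ → EuclideanSpace ℝ (Fin d))
    (hx : ∀ u > (0 : ℝ), HasDerivAt x ((1 / u) • (x u - M (x u) u)) u)
    (s t : ℝ) (hs : 0 < s) (hst : s ≤ t)
    (s' t' : ℝ) (hs' : s' = s / (1 + s)) (ht' : t' = t / (1 + t)) :
    (∀ u' ∈ Set.Ioo (0 : ℝ) 1,
      HasDerivAt (fun v => (1 - v) • x (v / (1 - v)))
        ((1 / u') • ((1 - u') • x (u' / (1 - u')) -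
          M ((1 / (1 - u')) • ((1 - u') • x (u' / (1 - u')))) (u' / (1 - u')))) u') ∧
    (1 - t') • x (t' / (1 - t')) = (1 / (1 + t)) • x t ∧
    x s = (1 + s) • ((1 - s') • x (s' / (1 - s'))) := by
  have hs1 : 1 + s ≠ 0 := by positivity
  have ht1 : 1 + t ≠ 0 := by linarith
  have one_sub_time (a : ℝ) (ha : 1 + a ≠ 0) : 1 - a / (1 + a) = 1 / (1 + a) := by
    field_simp
    ring
  have time_inv (a : ℝ) (ha : 1 + a ≠ 0) : a / (1 + a) / (1 - a / (1 + a)) = a := by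
    rw [one_sub_time a ha]
    field_simp
  refine ⟨?_, ?_, ?_⟩
  · rintro v ⟨hv0, hv1⟩
    have hv : 1 - v ≠ 0 := by linarith
    have hsub : HasDerivAt (fun w : ℝ => 1 - w) (-1) v := (hasDerivAt_id v).const_sub 1
    have htime : HasDerivAt (fun w : ℝ => w / (1 - w)) (1 / (1 - v) ^ 2) v := by
      refine ((hasDerivAt_id v).fun_div hsub hv).congr_deriv ?_
      simp
    have hpos : 0 < v / (1 - v) := div_pos hv0 (by linarith)
    refine (hsub.fun_smul ((hx _ hpos).scomp v htime)).congr_deriv ?_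
    rw [smul_smul (1 / (1 - v)), one_div_mul_cancel hv, one_smul]
    simp only [Function.comp_apply]
    match_scalars <;> field_simp
    ring
  · rw [ht', time_inv t ht1, one_sub_time t ht1]
  · rw [hs', time_inv s hs1, one_sub_time s hs1, smul_smul, mul_one_div_cancel hs1, one_smul]
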